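/- Let A be a non-unital C*-algebra and let A♯ denote its minimal unitization. Then A is weakly central if and only if A♯ is weakly central. -/

import Mathlib

open Filter Topology Pointwise

namespace CQP

variable {R : Type*} [NonUnitalRing R] [TopologicalSpace R]

/-- `I` is a closed two-sided ideal of the (C*-)algebra `S` (a subset of the ambient algebra). -/
def IsIdealOf (I S : Set R) : Prop :=
  I ⊆ S ∧ IsClosed I ∧ (0 : R) ∈ I ∧
  (∀ x ∈ I, ∀ y ∈ I, x + y ∈ I) ∧ (∀ x ∈ I, -x ∈ I) ∧
  (∀ x ∈ I, ∀ a ∈ S, a * x ∈ I ∧ x * a ∈ I)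

/-- The centre of the algebra `S`. -/
def centerOf (S : Set R) : Set R := {z ∈ S | ∀ x ∈ S, z * x = x * z}

/-- `e` is a unit for `S` relative to (modulo) the ideal `M`. -/
def IsRelUnitMod (S M : Set R) (e : R) : Prop :=
  e ∈ S ∧ ∀ x ∈ S, x - x * e ∈ M ∧ x - e * x ∈ M

/-- `M` is a modular maximal ideal of the algebra `S`. -/
def IsModMaxIdealOf (M S : Set R) : Prop :=
  IsIdealOf M S ∧ M ≠ S ∧
  (∀ I, IsIdealOf I S → M ⊆ I → I = M ∨ I = S) ∧
  ∃ e, IsRelUnitMod S M e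

/-- The algebra `S` is weakly central. -/
def WeaklyCentral (S : Set R) : Prop :=
  (∀ M, IsModMaxIdealOf M S → ¬ centerOf S ⊆ M) ∧
  (∀ M N, IsModMaxIdealOf M S → IsModMaxIdealOf N S →
    M ∩ centerOf S = N ∩ centerOf S → M = N)

/-- The algebra `S` has the centre-quotient property: every central element of a quotient
of `S` lifts to a central element of `S` modulo the ideal. -/
def HasCQ (S : Set R) : Prop :=
  ∀ I, IsIdealOf I S → ∀ a ∈ S, (∀ x ∈ S, a * x - x * a ∈ I) →
    ∃ z ∈ centerOf S, a - z ∈ I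

/-- `a` is a CQ-element of the algebra `S`. -/
def IsCQElem (S : Set R) (a : R) : Prop :=
  a ∈ S ∧ ∀ I, IsIdealOf I S → (∀ x ∈ S, a * x - x * a ∈ I) →
    ∃ z ∈ centerOf S, a - z ∈ I

/-- The set of CQ-elements of `S`. -/
def CQset (S : Set R) : Set R := {a | IsCQElem S a}

/-- The set `T_A` of modular maximal ideals witnessing the failure of weak centrality. -/
def Tset (S : Set R) : Set (Set R) :=
  {M | IsModMaxIdealOf M S ∧
    (centerOf S ⊆ M ∨ ∃ N, IsModMaxIdealOf N S ∧ N ≠ M ∧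
      ¬ centerOf S ⊆ M ∧ ¬ centerOf S ⊆ N ∧ M ∩ centerOf S = N ∩ centerOf S)}

/-- The closed two-sided ideal of `S` generated by the set `X`. -/
def genIdealOf (S X : Set R) : Set R := ⋂₀ {I | IsIdealOf I S ∧ X ⊆ I}

/-- The quotient `A/J` (of the full algebra by the ideal `J`) has the centre-quotient
property, expressed via the correspondence between ideals of `A/J` and ideals of `A`
containing `J`. -/
def HasCQmod (J : Set R) : Prop :=
  ∀ I : Set R, IsIdealOf I (Set.univ : Set R) → J ⊆ I → ∀ a : R,
    (∀ x : R, a * x - x * a ∈ I) →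
      ∃ z : R, (∀ x : R, z * x - x * z ∈ J) ∧ a - z ∈ I


end CQP

namespace CQP

section NonUnital

variable {S : Type*} [NonUnitalRing S] [TopologicalSpace S]

theorem IsIdealOf.mul_left {I : Set S}
    (hI : IsIdealOf I Set.univ) (a : S) {x : S} (hx : x ∈ I) : a * x ∈ I :=
  (hI.2.2.2.2.2 x hx a trivial).1

theorem IsIdealOf.mul_right {I : Set S}
    (hI : IsIdealOf I Set.univ) (a : S) {x : S} (hx : x ∈ I) : x * a ∈ I :=
  (hI.2.2.2.2.2 x hx a trivial).2

theorem IsIdealOf.add {I T : Set S}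
    (hI : IsIdealOf I T) {x y : S} (hx : x ∈ I) (hy : y ∈ I) : x + y ∈ I :=
  hI.2.2.2.1 x hx y hy

end NonUnital

section Unital

variable {R : Type*} [Ring R] [TopologicalSpace R]

theorem IsIdealOf.eq_univ {I : Set R} (hI : IsIdealOf I Set.univ) (h : (1 : R) ∈ I) :
    I = Set.univ :=
  Set.eq_univ_of_forall fun x => by simpa using hI.mul_left x h

theorem IsModMaxIdealOf.one_notMem {N : Set R} (hN : IsModMaxIdealOf N Set.univ) :
    (1 : R) ∉ N :=
  fun h => hN.2.1 (hN.1.eq_univ h)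

/-- A modular maximal ideal of a unital algebra is prime with respect to central elements. -/
theorem IsModMaxIdealOf.mem_of_mul_mem [ContinuousMul R] {N : Set R}
    (hN : IsModMaxIdealOf N Set.univ) {z w : R} (hw : w ∈ centerOf Set.univ)
    (hwN : w ∉ N) (h : z * w ∈ N) : z ∈ N := by
  have hJ : IsIdealOf {x : R | x * w ∈ N} Set.univ := by
    refine ⟨Set.subset_univ _, hN.1.2.1.preimage (continuous_mul_const w), ?_, ?_, ?_, ?_⟩
    · simpa using hN.1.2.2.1
    · intro x hx y hy
      simpa [add_mul] using hN.1.add hx hy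
    · intro x hx
      simpa using hN.1.2.2.2.2.1 _ hx
    · intro x hx a _
      refine ⟨?_, ?_⟩
      · simpa [mul_assoc] using hN.1.mul_left a hx
      · have := hN.1.mul_right a hx
        rwa [mul_assoc, hw.2 a trivial, ← mul_assoc] at this
  rcases hN.2.2.1 _ hJ fun x hx => hN.1.mul_right w hx with h' | h'
  · exact h' ▸ h
  · exact absurd (by simpa using (h' ▸ trivial : (1 : R) ∈ {x : R | x * w ∈ N})) hwN

end Unital

open Unitization

variable {A : Type*} [NonUnitalCStarAlgebra A]

/-- The ideal of all elements of the unitization which multiply `A` into `I`. -/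
def multiplierIdeal (I : Set A) : Set (Unitization ℂ A) :=
  {x | ∀ a : A, x.fst • a + x.snd * a ∈ I ∧ x.fst • a + a * x.snd ∈ I}

theorem mem_multiplierIdeal {I : Set A} {x : Unitization ℂ A} :
    x ∈ multiplierIdeal I ↔ ∀ a : A, (∃ b ∈ I, (b : Unitization ℂ A) = x * a) ∧
      ∃ b ∈ I, (b : Unitization ℂ A) = a * x := by
  have h₁ (a : A) : ((x.fst • a + x.snd * a : A) : Unitization ℂ A) = x * a := by
    ext <;> simp
  have h₂ (a : A) : ((x.fst • a + a * x.snd : A) : Unitization ℂ A) = a * x := by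
    ext <;> simp
  refine forall_congr' fun a => ?_
  rw [← h₁, ← h₂]
  simp only [inr_injective.eq_iff, exists_eq_right]

theorem isClosed_multiplierIdeal {I : Set A} (hI : IsClosed I) :
    IsClosed (multiplierIdeal I) := by
  have hf : Continuous (fun x : Unitization ℂ A => x.fst) :=
    continuous_fst.comp (uniformEquivProd (𝕜 := ℂ) (A := A)).continuous
  have hs : Continuous (fun x : Unitization ℂ A => x.snd) :=
    continuous_snd.comp (uniformEquivProd (𝕜 := ℂ) (A := A)).continuous
  simp only [multiplierIdeal, Set.ofPred_forall]
  refine isClosed_iInter fun a => IsClosed.inter (hI.preimage ?_) (hI.preimage ?_) <;> fun_prop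

theorem isIdealOf_multiplierIdeal {I : Set A} (hI : IsIdealOf I Set.univ)
    (hsmul : ∀ (c : ℂ), ∀ x ∈ I, c • x ∈ I) : IsIdealOf (multiplierIdeal I) Set.univ := by
  refine ⟨Set.subset_univ _, isClosed_multiplierIdeal hI.2.1, ?_, ?_, ?_, ?_⟩
  · intro a
    simpa using hI.2.2.1
  · intro x hx y hy a
    refine ⟨?_, ?_⟩
    · convert hI.add (hx a).1 (hy a).1 using 1
      simp only [fst_add, snd_add, add_smul, add_mul]; abel
    · convert hI.add (hx a).2 (hy a).2 using 1
      simp only [fst_add, snd_add, add_smul, mul_add]; abel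
  · intro x hx a
    refine ⟨?_, ?_⟩
    · convert hI.2.2.2.2.1 _ (hx a).1 using 1
      simp only [fst_neg, snd_neg, neg_smul, neg_mul]; abel
    · convert hI.2.2.2.2.1 _ (hx a).2 using 1
      simp only [fst_neg, snd_neg, neg_smul, mul_neg]; abel
  · intro x hx y _
    refine ⟨fun a => ⟨?_, ?_⟩, fun a => ⟨?_, ?_⟩⟩
    · convert hI.add (hsmul y.fst _ (hx a).1) (hI.mul_left y.snd (hx a).1) using 1
      simp only [fst_mul, snd_mul, add_mul, mul_add, smul_add, smul_smul, smul_mul_assoc,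
        mul_smul_comm, mul_assoc]
      abel
    · convert (hx (y.fst • a + a * y.snd)).2 using 1
      simp only [fst_mul, snd_mul, add_mul, mul_add, smul_add, smul_smul, smul_mul_assoc,
        mul_smul_comm, mul_assoc, mul_comm y.fst]
      abel
    · convert (hx (y.fst • a + y.snd * a)).1 using 1
      simp only [fst_mul, snd_mul, add_mul, mul_add, smul_add, smul_smul, smul_mul_assoc,
        mul_smul_comm, mul_assoc]
      abel
    · convert hI.add (hsmul y.fst _ (hx a).2) (hI.mul_right y.snd (hx a).2) using 1
      simp only [fst_mul, snd_mul, add_mul, mul_add, smul_add, smul_smul, smul_mul_assoc,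
        mul_smul_comm, mul_assoc, mul_comm y.fst]
      abel

theorem IsIdealOf.smul_mem {I M : Set A} (hI : IsIdealOf I Set.univ) (hMI : M ⊆ I) {e : A}
    (he : IsRelUnitMod Set.univ M e) (c : ℂ) {x : A} (hx : x ∈ I) : c • x ∈ I := by
  have h₁ := hMI (he.2 (c • x) trivial).1
  have h₂ := hI.mul_right (c • e) hx
  simpa [mul_smul_comm, smul_mul_assoc] using hI.add h₁ h₂

theorem IsIdealOf.preimage_inr {N : Set (Unitization ℂ A)} (hN : IsIdealOf N Set.univ) :
    IsIdealOf ((inr : A → Unitization ℂ A) ⁻¹' N) Set.univ := by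
  refine ⟨Set.subset_univ _, hN.2.1.preimage (isometry_inr (𝕜 := ℂ) (A := A)).continuous,
    ?_, ?_, ?_, ?_⟩
  · simpa using hN.2.2.1
  · intro x hx y hy
    simpa using hN.add hx hy
  · intro x hx
    simpa using hN.2.2.2.2.1 _ hx
  · intro x hx a _
    refine ⟨?_, ?_⟩
    · simpa using hN.mul_left (a : Unitization ℂ A) hx
    · simpa using hN.mul_right (a : Unitization ℂ A) hx

theorem inr_mem_multiplierIdeal {I : Set A} (hI : IsIdealOf I Set.univ) {x : A} (hx : x ∈ I) :
    (x : Unitization ℂ A) ∈ multiplierIdeal I :=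
  fun a => by simpa using ⟨hI.mul_right a hx, hI.mul_left a hx⟩

theorem inr_mem_multiplierIdeal_iff {M : Set A} (hM : IsIdealOf M Set.univ) {e : A}
    (he : IsRelUnitMod Set.univ M e) {x : A} :
    (x : Unitization ℂ A) ∈ multiplierIdeal M ↔ x ∈ M := by
  refine ⟨fun h => ?_, inr_mem_multiplierIdeal hM⟩
  have h₁ := (h e).1
  simp only [fst_inr, snd_inr, zero_smul, zero_add] at h₁
  simpa using hM.add (he.2 x trivial).1 h₁

theorem one_sub_inr_mem_multiplierIdeal {M : Set A} {e : A}
    (he : IsRelUnitMod Set.univ M e) : 1 - (e : Unitization ℂ A) ∈ multiplierIdeal M := fun a => by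
  have := he.2 a trivial
  simpa [sub_eq_add_neg] using this.symm

theorem subset_multiplierIdeal {N : Set (Unitization ℂ A)} (hN : IsIdealOf N Set.univ) {I : Set A}
    (h : (inr : A → Unitization ℂ A) ⁻¹' N ⊆ I) : N ⊆ multiplierIdeal I := by
  intro x hx a
  refine ⟨h ?_, h ?_⟩
  · have : ((x.fst • a + x.snd * a : A) : Unitization ℂ A) = x * a := by ext <;> simp
    rw [Set.mem_preimage, this]
    exact hN.mul_right _ hx
  · have : ((x.fst • a + a * x.snd : A) : Unitization ℂ A) = a * x := by ext <;> simp
    rw [Set.mem_preimage, this]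
    exact hN.mul_left _ hx

theorem IsIdealOf.eq_univ_of_one_sub_inr_mem {N : Set (Unitization ℂ A)}
    (hN : IsIdealOf N Set.univ) {e : A} (he : 1 - (e : Unitization ℂ A) ∈ N)
    (he' : (e : Unitization ℂ A) ∈ N) : N = Set.univ :=
  hN.eq_univ (by simpa using hN.add he he')

theorem isRelUnitMod_univ_one {N : Set (Unitization ℂ A)} (hN : IsIdealOf N Set.univ) :
    IsRelUnitMod Set.univ N 1 :=
  ⟨trivial, by simpa using hN.2.2.1⟩

theorem IsModMaxIdealOf.multiplierIdeal {M : Set A} (hM : IsModMaxIdealOf M Set.univ) :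
    IsModMaxIdealOf (multiplierIdeal M) Set.univ := by
  obtain ⟨hM₁, hM₂, hM₃, e, he⟩ := hM
  have hJ := isIdealOf_multiplierIdeal hM₁ fun c x hx => hM₁.smul_mem subset_rfl he c hx
  refine ⟨hJ, fun h => hM₂ <| Set.eq_univ_of_forall fun x => ?_, fun I hI hMI => ?_,
    1, isRelUnitMod_univ_one hJ⟩
  · exact (inr_mem_multiplierIdeal_iff hM₁ he).1 (h ▸ trivial)
  · rcases hM₃ _ hI.preimage_inr fun x hx => hMI (inr_mem_multiplierIdeal hM₁ hx) with h | h
    · exact .inl <| (subset_multiplierIdeal hI h.le).antisymm hMI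
    · exact .inr <| hI.eq_univ_of_one_sub_inr_mem (hMI (one_sub_inr_mem_multiplierIdeal he))
        (h ▸ trivial : e ∈ (inr : A → Unitization ℂ A) ⁻¹' I)

theorem IsModMaxIdealOf.preimage_inr {N : Set (Unitization ℂ A)}
    (hN : IsModMaxIdealOf N Set.univ) {e : A} (he : 1 - (e : Unitization ℂ A) ∈ N) :
    IsModMaxIdealOf ((inr : A → Unitization ℂ A) ⁻¹' N) Set.univ := by
  have hM := hN.1.preimage_inr
  have heM : IsRelUnitMod Set.univ ((inr : A → Unitization ℂ A) ⁻¹' N) e := by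
    refine ⟨trivial, fun x _ => ⟨?_, ?_⟩⟩
    · simpa [mul_sub] using hN.1.mul_left (x : Unitization ℂ A) he
    · simpa [sub_mul] using hN.1.mul_right (x : Unitization ℂ A) he
  refine ⟨hM, fun h => hN.2.1 <| hN.1.eq_univ_of_one_sub_inr_mem he
    (h ▸ trivial : e ∈ (inr : A → Unitization ℂ A) ⁻¹' N), fun I hI hNI => ?_, e, heM⟩
  rcases hN.2.2.1 _ (isIdealOf_multiplierIdeal hI fun c x hx => hI.smul_mem hNI heM c hx)
    (subset_multiplierIdeal hN.1 hNI) with h | h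
  · exact .inl <| Set.Subset.antisymm (fun x hx => h ▸ inr_mem_multiplierIdeal hI hx) hNI
  · refine .inr <| Set.eq_univ_of_forall fun x => ?_
    have h₁ : (1 : Unitization ℂ A) ∈ CQP.multiplierIdeal I := h ▸ trivial
    simpa using (h₁ x).1

theorem multiplierIdeal_preimage_inr {N : Set (Unitization ℂ A)}
    (hN : IsIdealOf N Set.univ) {e : A} (he : 1 - (e : Unitization ℂ A) ∈ N) :
    multiplierIdeal ((inr : A → Unitization ℂ A) ⁻¹' N) = N := by
  refine Set.Subset.antisymm (fun x hx => ?_) (subset_multiplierIdeal hN subset_rfl)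
  obtain ⟨b, hb, hbx⟩ := (mem_multiplierIdeal.1 hx e).1
  have h₁ : x * e ∈ N := hbx ▸ hb
  simpa [mul_sub] using hN.add (hN.mul_left x he) h₁

theorem exists_one_sub_inr_mem {N : Set (Unitization ℂ A)} (hN : IsIdealOf N Set.univ)
    {x : Unitization ℂ A} (hx : x ∈ N) (hx₀ : x.fst ≠ 0) :
    ∃ e : A, 1 - (e : Unitization ℂ A) ∈ N := by
  refine ⟨-(x.fst⁻¹ • x.snd), ?_⟩
  convert hN.mul_left (inl x.fst⁻¹) hx using 1
  ext <;> simp [hx₀]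

theorem isIdealOf_ker_fst : IsIdealOf {x : Unitization ℂ A | x.fst = 0} Set.univ := by
  have hf : Continuous (fun x : Unitization ℂ A => x.fst) :=
    continuous_fst.comp (uniformEquivProd (𝕜 := ℂ) (A := A)).continuous
  refine ⟨Set.subset_univ _, isClosed_singleton.preimage hf, ?_, ?_, ?_, ?_⟩ <;>
    simp +contextual

theorem inr_snd_of_fst_eq_zero {𝕜 S : Type*} [Zero 𝕜] {x : Unitization 𝕜 S} (hx : x.fst = 0) :
    (x.snd : Unitization 𝕜 S) = x := by
  ext <;> simp [hx]

theorem isModMaxIdealOf_ker_fst :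
    IsModMaxIdealOf {x : Unitization ℂ A | x.fst = 0} Set.univ := by
  refine ⟨isIdealOf_ker_fst, fun h => ?_, fun I hI hAI => ?_, 1,
    isRelUnitMod_univ_one isIdealOf_ker_fst⟩
  · have : (1 : Unitization ℂ A) ∈ {x : Unitization ℂ A | x.fst = 0} := h ▸ trivial
    simp at this
  · by_cases h : ∃ x ∈ I, x.fst ≠ 0
    · obtain ⟨x, hx, hx₀⟩ := h
      obtain ⟨e, he⟩ := exists_one_sub_inr_mem hI hx hx₀
      exact .inr <| hI.eq_univ_of_one_sub_inr_mem he (hAI (by simp))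
    · push Not at h
      exact .inl <| Set.Subset.antisymm h hAI

/-- A modular maximal ideal of the unitization is either `A` itself or it contains `1 - e` for
some `e` in `A`. -/
theorem IsModMaxIdealOf.eq_ker_fst_or {N : Set (Unitization ℂ A)}
    (hN : IsModMaxIdealOf N Set.univ) :
    N = {x | x.fst = 0} ∨ ∃ e : A, 1 - (e : Unitization ℂ A) ∈ N := by
  by_cases h : ∃ x ∈ N, x.fst ≠ 0
  · obtain ⟨x, hx, hx₀⟩ := h
    exact .inr <| exists_one_sub_inr_mem hN.1 hx hx₀
  · push Not at h
    refine .inl ((hN.2.2.1 _ isIdealOf_ker_fst h).resolve_right ?_).symm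
    exact isModMaxIdealOf_ker_fst.2.1

theorem mem_centerOf_unitization {x : Unitization ℂ A} :
    x ∈ centerOf (Set.univ : Set (Unitization ℂ A)) ↔ x.snd ∈ centerOf (Set.univ : Set A) := by
  refine ⟨fun h => ⟨trivial, fun a _ => ?_⟩, fun h => ⟨trivial, fun y _ => ?_⟩⟩
  · simpa using congr_arg (·.snd) (h.2 (a : Unitization ℂ A) trivial)
  · ext
    · simp [mul_comm]
    · simp [h.2 y.snd trivial, add_comm]

theorem WeaklyCentral.unitization (h : WeaklyCentral (Set.univ : Set A)) :
    WeaklyCentral (Set.univ : Set (Unitization ℂ A)) := by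
  have key {N : Set (Unitization ℂ A)} (hN : IsModMaxIdealOf N Set.univ) {e : A}
      (he : 1 - (e : Unitization ℂ A) ∈ N)
      (hZ : {x : Unitization ℂ A | x.fst = 0} ∩ centerOf Set.univ = N ∩ centerOf Set.univ) :
      False :=
    h.1 _ (hN.preimage_inr he) fun z hz =>
      (hZ.subset ⟨fst_inr ℂ z, mem_centerOf_unitization.2 (by simpa using hz)⟩).1
  refine ⟨fun N hN hZ => hN.one_notMem (hZ ⟨trivial, by simp⟩), fun N₁ N₂ hN₁ hN₂ hZ => ?_⟩
  rcases hN₁.eq_ker_fst_or with rfl | ⟨e₁, he₁⟩ <;> rcases hN₂.eq_ker_fst_or with rfl | ⟨e₂, he₂⟩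
  · rfl
  · exact (key hN₂ he₂ hZ).elim
  · exact (key hN₁ he₁ hZ.symm).elim
  · rw [← multiplierIdeal_preimage_inr hN₁.1 he₁, ← multiplierIdeal_preimage_inr hN₂.1 he₂]
    congr 1
    refine h.2 _ _ (hN₁.preimage_inr he₁) (hN₂.preimage_inr he₂) ?_
    ext z
    have := Set.ext_iff.1 hZ (z : Unitization ℂ A)
    simpa only [Set.mem_inter_iff, Set.mem_preimage, mem_centerOf_unitization, snd_inr] using this

theorem WeaklyCentral.of_unitization (h : WeaklyCentral (Set.univ : Set (Unitization ℂ A))) :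
    WeaklyCentral (Set.univ : Set A) := by
  have hZ {M : Set A} (hM : IsModMaxIdealOf M Set.univ) : ¬ centerOf Set.univ ⊆ M := by
    intro hZM
    obtain ⟨e, he⟩ := hM.2.2.2
    have heN := one_sub_inr_mem_multiplierIdeal he
    have hN := hM.multiplierIdeal
    have hA : multiplierIdeal M = {x : Unitization ℂ A | x.fst = 0} := by
      refine h.2 _ _ hN isModMaxIdealOf_ker_fst ?_
      ext x
      refine and_congr_left fun hx => ?_
      have hxN := inr_mem_multiplierIdeal hM.1 (hZM (mem_centerOf_unitization.1 hx))
      refine ⟨fun hxM => ?_, fun hx₀ => inr_snd_of_fst_eq_zero hx₀ ▸ hxN⟩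
      by_contra hx₀
      refine hN.one_notMem ?_
      have h₁ := hN.1.mul_left (inl x.fst⁻¹) (hN.1.add hxM (hN.1.2.2.2.2.1 _ hxN))
      convert h₁ using 1
      have hx₀ : x.fst ≠ 0 := hx₀
      ext <;> simp [hx₀]
    rw [hA] at heN
    simp [sub_eq_add_neg] at heN
  have key {M₁ M₂ : Set A} (hM₁ : IsModMaxIdealOf M₁ Set.univ)
      (hM₂ : IsModMaxIdealOf M₂ Set.univ)
      (hZM : M₁ ∩ centerOf Set.univ = M₂ ∩ centerOf Set.univ) {x : Unitization ℂ A}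
      (hx : x ∈ centerOf Set.univ) (hxM : x ∈ multiplierIdeal M₁) : x ∈ multiplierIdeal M₂ := by
    obtain ⟨w, hw, hwM⟩ := Set.not_subset.1 (hZ hM₂)
    obtain ⟨e, he⟩ := hM₂.2.2.2
    refine hM₂.multiplierIdeal.mem_of_mul_mem (mem_centerOf_unitization.2 (by simpa using hw))
      (mt (inr_mem_multiplierIdeal_iff hM₂.1 he).1 hwM) ?_
    obtain ⟨b, hb, hbx⟩ := (mem_multiplierIdeal.1 hxM w).1
    rw [← hbx]
    refine inr_mem_multiplierIdeal hM₂.1 (hZM.subset ⟨hb, ?_⟩).1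
    have hbc : (b : Unitization ℂ A) ∈ centerOf Set.univ := by
      have hw' : (w : Unitization ℂ A) ∈ centerOf Set.univ :=
        mem_centerOf_unitization.2 (by simpa using hw)
      refine ⟨trivial, fun y _ => ?_⟩
      rw [hbx, mul_assoc, hw'.2 y trivial, ← mul_assoc, hx.2 y trivial, mul_assoc]
    simpa using mem_centerOf_unitization.1 hbc
  refine ⟨fun M hM => hZ hM, fun M₁ M₂ hM₁ hM₂ hZM => ?_⟩
  have hN : multiplierIdeal M₁ = multiplierIdeal M₂ := by
    refine h.2 _ _ hM₁.multiplierIdeal hM₂.multiplierIdeal ?_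
    ext x
    exact and_congr_left fun hx => ⟨key hM₁ hM₂ hZM hx, key hM₂ hM₁ hZM.symm hx⟩
  obtain ⟨e₁, he₁⟩ := hM₁.2.2.2
  obtain ⟨e₂, he₂⟩ := hM₂.2.2.2
  ext x
  rw [← inr_mem_multiplierIdeal_iff hM₁.1 he₁, hN, inr_mem_multiplierIdeal_iff hM₂.1 he₂]

end CQP

open CQP

/-- **Proposition 3.8.** A non-unital C*-algebra `A` is weakly central if and only if
its minimal unitization `A♯ = Unitization ℂ A` is weakly central. -/
theorem stmt3 {A : Type*} [NonUnitalCStarAlgebra A]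
    (hnu : ¬ ∃ e : A, ∀ x : A, e * x = x ∧ x * e = x) :
    WeaklyCentral (Set.univ : Set A) ↔
      WeaklyCentral (Set.univ : Set (Unitization ℂ A)) := ⟨fun h => h.unitization, fun h => h.of_unitization⟩
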